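/- Let D be a real m×d matrix with nonzero columns d_1,…,d_d and mutual coherence μ(D) = max_{i≠j} |d_i^T d_j| / (‖d_i‖₂ ‖d_j‖₂), and suppose μ(D) > 0. Then any set S of column indices with |S| < 1 + 1/μ(D) indexes a linearly independent family of columns of D. -/

import Mathlib

/-- The ℓ₂ norm of the `i`-th column of `D`. -/
noncomputable def colNorm {m d : ℕ} (D : Matrix (Fin m) (Fin d) ℝ) (i : Fin d) : ℝ :=
  Real.sqrt (∑ t, (D t i) ^ 2)

/-- The set of normalized absolute inner products between distinct columns of `D`;
its greatest element is the mutual coherence `μ(D)`. -/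
def cohSet {m d : ℕ} (D : Matrix (Fin m) (Fin d) ℝ) : Set ℝ :=
  {r | ∃ i j : Fin d, i ≠ j ∧ r = |∑ t, D t i * D t j| / (colNorm D i * colNorm D j)}

theorem colNorm_pos {m d : ℕ} (D : Matrix (Fin m) (Fin d) ℝ) {i : Fin d}
    (hi : (fun t => D t i) ≠ 0) : 0 < colNorm D i := by
  obtain ⟨t, ht⟩ := Function.ne_iff.mp hi
  exact Real.sqrt_pos.mpr <| Finset.sum_pos' (fun _ _ => sq_nonneg _)
    ⟨t, Finset.mem_univ t, sq_pos_of_ne_zero ht⟩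

theorem colNorm_mul_self {m d : ℕ} (D : Matrix (Fin m) (Fin d) ℝ) (i : Fin d) :
    colNorm D i * colNorm D i = ∑ t, D t i * D t i := by
  rw [colNorm, Real.mul_self_sqrt (Finset.sum_nonneg fun _ _ => sq_nonneg _)]
  simp only [sq]

/-- The Gram matrix of the normalized columns of `D` indexed by `S`. -/
noncomputable def normalizedGram {m d : ℕ} (D : Matrix (Fin m) (Fin d) ℝ) (S : Finset (Fin d)) :
    Matrix S S ℝ :=
  Matrix.of fun i j => (∑ t, D t i * D t j) / (colNorm D i * colNorm D j)

theorem det_normalizedGram_ne_zero {m d : ℕ} (D : Matrix (Fin m) (Fin d) ℝ)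
    (hcols : ∀ i : Fin d, (fun t => D t i) ≠ 0) {μ : ℝ} (hμ : μ ∈ upperBounds (cohSet D))
    (hpos : 0 < μ) (S : Finset (Fin d)) (hcard : (S.card : ℝ) < 1 + 1 / μ) :
    (normalizedGram D S).det ≠ 0 := by
  refine det_ne_zero_of_sum_row_lt_diag fun k => ?_
  have hk := colNorm_pos D (hcols k)
  have hdiag : normalizedGram D S k k = 1 := by
    rw [normalizedGram, Matrix.of_apply, ← colNorm_mul_self, div_self (mul_pos hk hk).ne']
  have hoff : ∀ j ∈ Finset.univ.erase k, ‖normalizedGram D S k j‖ ≤ μ := by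
    intro j hj
    have hj' := colNorm_pos D (hcols j)
    rw [normalizedGram, Matrix.of_apply, Real.norm_eq_abs, abs_div, abs_of_pos (mul_pos hk hj')]
    exact hμ ⟨k, j, fun h => Finset.ne_of_mem_erase hj (Subtype.ext h.symm), rfl⟩
  calc ∑ j ∈ Finset.univ.erase k, ‖normalizedGram D S k j‖
      ≤ (Finset.univ.erase k).card • μ := Finset.sum_le_card_nsmul _ _ _ hoff
    _ = ((S.card : ℝ) - 1) * μ := by
      rw [nsmul_eq_mul, Finset.cast_card_erase_of_mem (Finset.mem_univ k), Finset.card_univ,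
        Fintype.card_coe]
    _ < 1 := (lt_div_iff₀ hpos).mp (by linarith)
    _ = ‖normalizedGram D S k k‖ := by rw [hdiag, norm_one]

/-- Any fewer than `1 + 1/μ(D)` columns of `D` are linearly independent. -/
theorem columns_linearIndependent_of_card_lt {m d : ℕ} (D : Matrix (Fin m) (Fin d) ℝ)
    (hcols : ∀ i : Fin d, (fun t => D t i) ≠ 0)
    (μ : ℝ) (hμ : IsGreatest (cohSet D) μ) (hpos : 0 < μ)
    (S : Finset (Fin d)) (hcard : (S.card : ℝ) < 1 + 1 / μ) :
    LinearIndependent ℝ (fun i : S => (fun t => D t (i : Fin d))) := by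
  rw [Fintype.linearIndependent_iff]
  intro g hg i
  have hmul : (normalizedGram D S).mulVec (fun j => g j * colNorm D j) = 0 := by
    ext k
    have hterm : ∀ j : S, normalizedGram D S k j * (g j * colNorm D j) =
        ∑ t, D t k / colNorm D k * (g j * D t j) := by
      intro j
      have hk := (colNorm_pos D (hcols k)).ne'
      have hj := (colNorm_pos D (hcols j)).ne'
      rw [normalizedGram, Matrix.of_apply, Finset.sum_div, Finset.sum_mul]
      refine Finset.sum_congr rfl fun t _ => ?_
      field_simp
    have hrow : ∀ t, ∑ j : S, g j * D t j = 0 := by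
      intro t
      simpa using congrFun hg t
    simp_rw [Matrix.mulVec, dotProduct, hterm]
    rw [Finset.sum_comm]
    simp_rw [← Finset.mul_sum, hrow, mul_zero, Finset.sum_const_zero, Pi.zero_apply]
  have hzero := congrFun (Matrix.eq_zero_of_mulVec_eq_zero
    (det_normalizedGram_ne_zero D hcols hμ.2 hpos S hcard) hmul) i
  exact (mul_eq_zero.mp hzero).resolve_right (colNorm_pos D (hcols i)).ne'
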